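/- Let T = X + iY satisfy assumption (A). Then for every ψ in C¹₁([a,b]), the commutator [ψ(Y), X] is a trace-class operator with ‖[ψ(Y), X]‖₁ ≤ ‖D²‖₁ · (1/√(2π)) ∫_ℝ |ψ̂(α)| |α| dα, and −i Tr([ψ(Y), X]) = Tr(ψ′(Y) D²). -/

import Mathlib

open scoped InnerProductSpace
open MeasureTheory Polynomial

namespace HHCP

variable {H : Type*} [NormedAddCommGroup H] [InnerProductSpace ℂ H] [CompleteSpace H]
  [TopologicalSpace.SeparableSpace H]

/-- `f(A)` for a function `f` of a real variable, applied to the (selfadjoint, hence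
star-normal) bounded operator `A` via the continuous functional calculus. -/
noncomputable def fc (f : ℝ → ℂ) (A : H →L[ℂ] H) : H →L[ℂ] H :=
  cfc (fun z : ℂ => f z.re) A

/-- `|A| = √(A⋆A)`. -/
noncomputable def absOp (A : H →L[ℂ] H) : H →L[ℂ] H :=
  cfc Real.sqrt (ContinuousLinearMap.adjoint A * A)

/-- `A` is of trace class, i.e. `∑ ⟪eᵢ, |A| eᵢ⟫ < ∞` (this is independent of the
choice of the Hilbert basis `e`). -/
def IsTraceClass {ι : Type*} (e : HilbertBasis ι ℂ H) (A : H →L[ℂ] H) : Prop :=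
  Summable fun i => (⟪e i, absOp A (e i)⟫_ℂ).re

/-- The trace norm `‖A‖₁ = Tr |A|`. -/
noncomputable def traceNorm {ι : Type*} (e : HilbertBasis ι ℂ H) (A : H →L[ℂ] H) : ℝ :=
  ∑' i, (⟪e i, absOp A (e i)⟫_ℂ).re

/-- The trace `Tr A = ∑ᵢ ⟪eᵢ, A eᵢ⟫`. -/
noncomputable def trace {ι : Type*} (e : HilbertBasis ι ℂ H) (A : H →L[ℂ] H) : ℂ :=
  ∑' i, ⟪e i, A (e i)⟫_ℂ

/-- `T` is hyponormal (`‖T⋆x‖ ≤ ‖Tx‖`, i.e. `[T⋆,T] ≥ 0`) and *purely* so: there is no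
nonzero closed subspace, invariant under `T` and `T⋆`, on which `T` is normal. -/
def PurelyHyponormal (T : H →L[ℂ] H) : Prop :=
  (∀ x : H, ‖ContinuousLinearMap.adjoint T x‖ ≤ ‖T x‖) ∧
  ∀ S : Submodule ℂ H, IsClosed (S : Set H) →
    (∀ x ∈ S, T x ∈ S) → (∀ x ∈ S, ContinuousLinearMap.adjoint T x ∈ S) →
    (∀ x ∈ S, ‖T x‖ = ‖ContinuousLinearMap.adjoint T x‖) → S = ⊥

/-- Assumption (A): `T = X + iY` is purely hyponormal with `X, Y` selfadjoint,
`[T⋆,T] = −2i[Y,X] = 2D²` is a positive trace-class operator, and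
`σ(X) ∪ σ(Y) ⊆ [a,b]`. -/
structure AssumptionA {ι : Type*} (e : HilbertBasis ι ℂ H)
    (X Y D2 : H →L[ℂ] H) (a b : ℝ) : Prop where
  hab : a ≤ b
  hX : IsSelfAdjoint X
  hY : IsSelfAdjoint Y
  hpure : PurelyHyponormal (X + Complex.I • Y)
  hD2 : (2 : ℂ) • D2 = (-(2 : ℂ) * Complex.I) • (Y * X - X * Y)
  hpos : D2.IsPositive
  htc : IsTraceClass e D2
  hspecX : spectrum ℝ X ⊆ Set.Icc a b
  hspecY : spectrum ℝ Y ⊆ Set.Icc a b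

/-- `ψ ∈ C¹₁`: `ψ(β) = (2π)^{-1/2} ∫ ψ̂(α) e^{iαβ} dα` for some `ψ̂` with
`∫ |ψ̂(α)|(1+|α|) dα < ∞`. -/
def MemC11 (ψ : ℝ → ℂ) : Prop :=
  ∃ g : ℝ → ℂ, Integrable g ∧ Integrable (fun α : ℝ => α • g α) ∧
    ∀ β : ℝ, ψ β = (Real.sqrt (2 * Real.pi))⁻¹ •
      ∫ α : ℝ, Complex.exp (Complex.I * (α : ℂ) * (β : ℂ)) • g α

/-- `ψ` is (the function given by) a polynomial with complex coefficients. -/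
def IsPolyFun (ψ : ℝ → ℂ) : Prop :=
  ∃ p : Polynomial ℂ, ∀ t : ℝ, ψ t = Polynomial.eval (t : ℂ) p

/-- `ψ` is either in `C¹₁([a,b])` or a polynomial. -/
def GoodFun (ψ : ℝ → ℂ) : Prop := MemC11 ψ ∨ IsPolyFun ψ

/-- `E` is the spectral measure of the selfadjoint operator `A`: a projection-valued,
countably additive measure on `ℝ` such that `⟪x, f(A) x⟫ = ∫ f dμ_x`, where `μ_x` is the
finite positive measure `μ_x(Δ) = ⟪x, E(Δ) x⟫`. -/
def IsSpectralMeasureOf (A : H →L[ℂ] H) (E : Set ℝ → H →L[ℂ] H) : Prop :=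
  (∀ Δ : Set ℝ, IsSelfAdjoint (E Δ)) ∧
  (∀ Δ Ω : Set ℝ, E (Δ ∩ Ω) = E Δ * E Ω) ∧
  E Set.univ = 1 ∧
  (∀ Δ : ℕ → Set ℝ, (∀ n, MeasurableSet (Δ n)) → Pairwise (Function.onFun Disjoint Δ) →
    ∀ x : H, HasSum (fun n => E (Δ n) x) (E (⋃ n, Δ n) x)) ∧
  ∀ x : H, ∃ μ : Measure ℝ, IsFiniteMeasure μ ∧
    (∀ Δ : Set ℝ, MeasurableSet Δ → (μ Δ).toReal = (⟪x, E Δ x⟫_ℂ).re) ∧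
    ∀ f : ℝ → ℝ, Continuous f → (⟪x, cfc f A x⟫_ℂ).re = ∫ t, f t ∂μ

/-- An indefinite integral `𝒥(χ_Δ)` of the characteristic function of `Δ`. -/
noncomputable def Jind (a : ℝ) (Δ : Set ℝ) (t : ℝ) : ℝ :=
  ∫ s in a..t, Set.indicator Δ (fun _ => (1 : ℝ)) s

/-- `𝒥(χ_Δ)(A)`. -/
noncomputable def JindOp (a : ℝ) (Δ : Set ℝ) (A : H →L[ℂ] H) : H →L[ℂ] H :=
  fc (fun t => (Jind a Δ t : ℂ)) A

/-- `ψ ∈ C¹([a,b])` with derivative `ψd` on `[a,b]`. -/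
def HasDerivOnIcc (ψ ψd : ℝ → ℂ) (a b : ℝ) : Prop :=
  (∀ t ∈ Set.Icc a b, HasDerivWithinAt ψ (ψd t) (Set.Icc a b) t) ∧
  ContinuousOn ψd (Set.Icc a b)

/-- `r` is a Carey–Pincus principal function for the pair `X, Y`: a nonnegative
`L¹([a,b]²)` function with `Tr(−i[ψ(Y), φ(X)]) = ∫∫ φ′(t) ψ′(λ) r(t,λ) dt dλ`
for all `ψ, φ ∈ C¹([a,b])`. -/
def IsPrincipalFunction {ι : Type*} (e : HilbertBasis ι ℂ H) (X Y : H →L[ℂ] H)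
    (a b : ℝ) (r : ℝ → ℝ → ℝ) : Prop :=
  IntegrableOn (fun q : ℝ × ℝ => r q.1 q.2) (Set.Icc a b ×ˢ Set.Icc a b) ∧
  (∀ᵐ q : ℝ × ℝ ∂(volume : Measure (ℝ × ℝ)),
    q ∈ Set.Icc a b ×ˢ Set.Icc a b → 0 ≤ r q.1 q.2) ∧
  ∀ ψ ψd φ φd : ℝ → ℂ, HasDerivOnIcc ψ ψd a b → HasDerivOnIcc φ φd a b →
    trace e ((-Complex.I) • (fc ψ Y * fc φ X - fc φ X * fc ψ Y)) =
      ∫ t in Set.Icc a b, ∫ l in Set.Icc a b, φd t * ψd l * (r t l : ℂ)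

/-- The Jacobian `J(F,G)(t,λ) = ∂F/∂t ∂G/∂λ − ∂F/∂λ ∂G/∂t`. -/
noncomputable def Jac (F G : ℝ → ℝ → ℂ) (t l : ℝ) : ℂ :=
  deriv (fun s => F s l) t * deriv (fun s => G t s) l -
    deriv (fun s => F t s) l * deriv (fun s => G s l) t

set_option linter.unusedSectionVars false

/-- Parseval in extended form. -/
lemma parseval_enorm {ι : Type*} (e : HilbertBasis ι ℂ H) (x : H) :
    ∑' j, ENNReal.ofReal (‖⟪e j, x⟫_ℂ‖ ^ 2) = ENNReal.ofReal (‖x‖ ^ 2) := by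
  have h := e.hasSum_inner_mul_inner x x
  have h2 : HasSum (fun j => ‖⟪e j, x⟫_ℂ‖ ^ 2) (‖x‖ ^ 2) := by
    have h3 := Complex.hasSum_re h
    convert h3 using 1
    · ext j
      rw [← inner_conj_symm x (e j), Complex.conj_mul']
      norm_cast
    · rw [inner_self_eq_norm_sq_to_K]
      norm_cast
  rw [← h2.tsum_eq, ENNReal.ofReal_tsum_of_nonneg (fun _ => by positivity) h2.summable]

lemma hs_swap {ι : Type*} (e : HilbertBasis ι ℂ H) (A : H →L[ℂ] H) :
    ∑' i, ENNReal.ofReal (‖A (e i)‖ ^ 2) =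
      ∑' i, ENNReal.ofReal (‖ContinuousLinearMap.adjoint A (e i)‖ ^ 2) := by
  simp_rw [← parseval_enorm e]
  rw [ENNReal.tsum_comm]
  congr 1; ext j; congr 1; ext i
  rw [ContinuousLinearMap.adjoint_inner_right, ← inner_conj_symm, RCLike.norm_conj]

lemma hs_contr {ι : Type*} (e : HilbertBasis ι ℂ H) (S B : H →L[ℂ] H)
    (hS : IsSelfAdjoint S) (hB : ‖B‖ ≤ 1) :
    ∑' i, ENNReal.ofReal (‖S (B (e i))‖ ^ 2) ≤ ∑' i, ENNReal.ofReal (‖S (e i)‖ ^ 2) := by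
  have h := hs_swap e (S * B)
  simp only [mul_apply_eq_comp] at h
  rw [h]
  refine ENNReal.tsum_le_tsum fun i => ENNReal.ofReal_le_ofReal ?_
  have h2 : ContinuousLinearMap.adjoint (S * B) (e i) = ContinuousLinearMap.adjoint B (S (e i)) := by
    have : ContinuousLinearMap.adjoint (S * B) = ContinuousLinearMap.adjoint B * S := by
      have := star_mul S B
      rw [hS.star_eq] at this
      exact this
    rw [this]; rfl
  rw [h2]
  gcongr
  refine (ContinuousLinearMap.le_opNorm _ _).trans ?_
  rw [LinearIsometryEquiv.norm_map]
  exact mul_le_of_le_one_left (norm_nonneg _) hB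

lemma hs_summable {ι : Type*} (e : HilbertBasis ι ℂ H) (S B : H →L[ℂ] H)
    (hS : IsSelfAdjoint S) (hB : ‖B‖ ≤ 1) (hs : Summable fun i => ‖S (e i)‖ ^ 2) :
    Summable (fun i => ‖S (B (e i))‖ ^ 2) ∧
      ∑' i, ‖S (B (e i))‖ ^ 2 ≤ ∑' i, ‖S (e i)‖ ^ 2 := by
  have h := hs_contr e S B hS hB
  rw [← ENNReal.ofReal_tsum_of_nonneg (fun _ => by positivity) hs] at h
  have h1 : Summable (fun i => ‖S (B (e i))‖ ^ 2) := by
    have := ENNReal.summable_toReal (ne_top_of_le_ne_top ENNReal.ofReal_ne_top h)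
    refine this.congr fun i => ENNReal.toReal_ofReal (by positivity)
  refine ⟨h1, ?_⟩
  rw [← ENNReal.ofReal_tsum_of_nonneg (fun _ => by positivity) h1] at h
  exact (ENNReal.ofReal_le_ofReal_iff (tsum_nonneg fun _ => by positivity)).1 h

lemma hs_prod {ι : Type*} (e : HilbertBasis ι ℂ H) (S B : H →L[ℂ] H)
    (hS : IsSelfAdjoint S) (hB : ‖B‖ ≤ 1) (hs : Summable fun i => ‖S (e i)‖ ^ 2) :
    Summable (fun p : ι × ι => ‖⟪e p.2, S (B (e p.1))⟫_ℂ‖ ^ 2) := by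
  have h := hs_contr e S B hS hB
  rw [← ENNReal.ofReal_tsum_of_nonneg (fun _ => by positivity) hs] at h
  simp_rw [← parseval_enorm e] at h
  rw [← ENNReal.tsum_prod] at h
  have := ENNReal.summable_toReal (ne_top_of_le_ne_top ENNReal.ofReal_ne_top h)
  refine this.congr fun i => ENNReal.toReal_ofReal (by positivity)

/-- A bound on the trace norm, in weak form. -/
def TB {ι : Type*} (e : HilbertBasis ι ℂ H) (A : H →L[ℂ] H) (M : ℝ) : Prop :=
  ∀ W : H →L[ℂ] H, ‖W‖ ≤ 1 → ∀ F : Finset ι, ∑ i ∈ F, ‖⟪W (e i), A (e i)⟫_ℂ‖ ≤ M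

lemma TB.summable {ι : Type*} {e : HilbertBasis ι ℂ H} {A : H →L[ℂ] H} {M : ℝ}
    (h : TB e A M) : Summable fun i => ‖⟪e i, A (e i)⟫_ℂ‖ :=
  summable_of_sum_le (fun _ => norm_nonneg _)
    (fun F => h 1 ContinuousLinearMap.norm_id_le F)

lemma TB.smul {ι : Type*} {e : HilbertBasis ι ℂ H} {A : H →L[ℂ] H} {M : ℝ}
    (h : TB e A M) (c : ℂ) : TB e (c • A) (‖c‖ * M) := by
  intro W hW F
  simp only [smul_apply, inner_smul_right, norm_mul, ← Finset.mul_sum]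
  exact mul_le_mul_of_nonneg_left (h W hW F) (norm_nonneg _)

lemma trace_smul' {ι : Type*} (e : HilbertBasis ι ℂ H) (A : H →L[ℂ] H) (c : ℂ) :
    trace e (c • A) = c * trace e A := by
  simp only [trace, smul_apply, inner_smul_right, tsum_mul_left]

lemma inner_USSV (S U V : H →L[ℂ] H) (hS : IsSelfAdjoint S) (x y : H) :
    ⟪x, (U * (S * S) * V) y⟫_ℂ = ⟪S (ContinuousLinearMap.adjoint U x), S (V y)⟫_ℂ := by
  have : ContinuousLinearMap.adjoint S = S := hS.star_eq
  conv_rhs => enter [2]; rw [← this]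
  rw [ContinuousLinearMap.adjoint_inner_left, ContinuousLinearMap.adjoint_inner_left]
  rfl

lemma norm_adj_le {U : H →L[ℂ] H} (hU : ‖U‖ ≤ 1) : ‖ContinuousLinearMap.adjoint U‖ ≤ 1 := by
  rwa [LinearIsometryEquiv.norm_map]

lemma TB_main {ι : Type*} (e : HilbertBasis ι ℂ H) (S U V : H →L[ℂ] H)
    (hS : IsSelfAdjoint S) (hU : ‖U‖ ≤ 1) (hV : ‖V‖ ≤ 1)
    (hs : Summable fun i => ‖S (e i)‖ ^ 2) :
    TB e (U * (S * S) * V) (∑' i, ‖S (e i)‖ ^ 2) := by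
  intro W hW F
  have hUW : ‖ContinuousLinearMap.adjoint U * W‖ ≤ 1 :=
    (norm_mul_le _ _).trans (mul_le_one₀ (norm_adj_le hU) (norm_nonneg _) hW)
  obtain ⟨a1, a2⟩ := hs_summable e S _ hS hUW hs
  obtain ⟨b1, b2⟩ := hs_summable e S V hS hV hs
  have c1 := a1.sum_le_tsum F (fun _ _ => by positivity)
  have c2 := b1.sum_le_tsum F (fun _ _ => by positivity)
  have : ∑ i ∈ F, ‖⟪W (e i), (U * (S * S) * V) (e i)⟫_ℂ‖ ≤
      ∑ i ∈ F, ((‖S ((ContinuousLinearMap.adjoint U * W) (e i))‖ ^ 2 + ‖S (V (e i))‖ ^ 2) / 2) := by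
    refine Finset.sum_le_sum fun i _ => ?_
    rw [inner_USSV S U V hS]
    refine (norm_inner_le_norm _ _).trans ?_
    have := two_mul_le_add_sq ‖S ((ContinuousLinearMap.adjoint U * W) (e i))‖ ‖S (V (e i))‖
    simp only [mul_apply_eq_comp] at this ⊢
    linarith
  rw [← Finset.sum_div, Finset.sum_add_distrib] at this
  linarith

lemma trace_cyc0 {ι : Type*} (e : HilbertBasis ι ℂ H) (S U V : H →L[ℂ] H)
    (hS : IsSelfAdjoint S) (hU : ‖U‖ ≤ 1) (hV : ‖V‖ ≤ 1)
    (hs : Summable fun i => ‖S (e i)‖ ^ 2) :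
    trace e (U * (S * S) * V) = ∑' j, ⟪S (e j), (V * U) (S (e j))⟫_ℂ := by
  have hSa : ContinuousLinearMap.adjoint S = S := hS.star_eq
  have p1 := hs_prod e S _ hS (norm_adj_le hU) hs
  have p2 := hs_prod e S _ hS hV hs
  have hsum : Summable (Function.uncurry fun i j =>
      ⟪S (ContinuousLinearMap.adjoint U (e i)), e j⟫_ℂ * ⟪e j, S (V (e i))⟫_ℂ) := by
    refine Summable.of_norm_bounded ((p1.add p2).div_const 2) fun p => ?_
    simp only [Function.uncurry, norm_mul]
    rw [← inner_conj_symm, RCLike.norm_conj]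
    have := two_mul_le_add_sq ‖⟪e p.2, S (ContinuousLinearMap.adjoint U (e p.1))⟫_ℂ‖
      ‖⟪e p.2, S (V (e p.1))⟫_ℂ‖
    linarith
  calc trace e (U * (S * S) * V)
      = ∑' i, ∑' j, ⟪S (ContinuousLinearMap.adjoint U (e i)), e j⟫_ℂ * ⟪e j, S (V (e i))⟫_ℂ := by
        refine tsum_congr fun i => ?_
        rw [inner_USSV S U V hS, e.tsum_inner_mul_inner]
    _ = ∑' j, ∑' i, ⟪S (ContinuousLinearMap.adjoint U (e i)), e j⟫_ℂ * ⟪e j, S (V (e i))⟫_ℂ :=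
        hsum.tsum_comm.symm
    _ = _ := by
        refine tsum_congr fun j => ?_
        have : ⟪S (e j), (V * U) (S (e j))⟫_ℂ =
            ⟪ContinuousLinearMap.adjoint V (S (e j)), U (S (e j))⟫_ℂ := by
          rw [ContinuousLinearMap.adjoint_inner_left]; rfl
        rw [this, ← e.tsum_inner_mul_inner]
        refine tsum_congr fun i => ?_
        rw [mul_comm]
        congr 1
        · rw [ContinuousLinearMap.adjoint_inner_left]
          conv_rhs => rw [← hSa, ContinuousLinearMap.adjoint_inner_left]
        · conv_lhs => rw [← hSa, ContinuousLinearMap.adjoint_inner_left]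
          rw [ContinuousLinearMap.adjoint_inner_left]

lemma trace_cyc {ι : Type*} (e : HilbertBasis ι ℂ H) (S U V : H →L[ℂ] H)
    (hS : IsSelfAdjoint S) (hU : ‖U‖ ≤ 1) (hV : ‖V‖ ≤ 1)
    (hs : Summable fun i => ‖S (e i)‖ ^ 2) :
    trace e (U * (S * S) * V) = trace e (V * U * (S * S)) := by
  have h1 : ‖(1 : H →L[ℂ] H)‖ ≤ 1 := ContinuousLinearMap.norm_id_le
  have := trace_cyc0 e S (V * U) 1 hS ((norm_mul_le _ _).trans (mul_le_one₀ hV (norm_nonneg _) hU))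
    h1 hs
  rw [trace_cyc0 e S U V hS hU hV hs]
  simpa using this.symm

lemma countable_basis {ι : Type*} (e : HilbertBasis ι ℂ H) : Countable ι := by
  have hd : Pairwise (Function.onFun Disjoint fun i => Metric.ball (e i) (1/2)) := by
    intro i j hij
    refine Metric.ball_disjoint_ball ?_
    have h2 : ‖e i - e j‖ ^ 2 = 2 := by
      rw [@norm_sub_sq ℂ, e.orthonormal.1 i, e.orthonormal.1 j, e.orthonormal.2 hij]; norm_num
    rw [dist_eq_norm]
    nlinarith [norm_nonneg (e i - e j)]
  exact hd.countable_of_isOpen_disjoint (fun i => Metric.isOpen_ball)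
    fun i => ⟨e i, by simp⟩

lemma TB.traceClass {ι : Type*} {e : HilbertBasis ι ℂ H} {A : H →L[ℂ] H} {M : ℝ}
    (h : TB e A M) : IsTraceClass e A ∧ traceNorm e A ≤ M := by
  have hsa : IsSelfAdjoint (star A * A) := IsSelfAdjoint.star_mul_self A
  have hspec : ∀ t ∈ spectrum ℝ (star A * A), 0 ≤ t := spectrum_star_mul_self_nonneg
  have hPdef : absOp A = cfc Real.sqrt (star A * A) := rfl
  have hP : 0 ≤ absOp A := by
    rw [hPdef]; exact cfc_nonneg fun t _ => Real.sqrt_nonneg t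
  have hP' := (ContinuousLinearMap.nonneg_iff_isPositive _).1 hP
  have hnn : ∀ i, 0 ≤ (⟪e i, absOp A (e i)⟫_ℂ).re := fun i => hP'.re_inner_nonneg_right (e i)
  have key : ∀ F : Finset ι, ∑ i ∈ F, (⟪e i, absOp A (e i)⟫_ℂ).re ≤ M := by
    intro F
    have key2 : ∀ ε : ℝ, 0 < ε → ∑ i ∈ F, (⟪e i, absOp A (e i)⟫_ℂ).re ≤ M + F.card * ε := by
      intro ε hε
      have hpos : ∀ t : ℝ, 0 < √t + ε := fun t => by positivity
      have hc : Continuous fun t : ℝ => (√t + ε)⁻¹ :=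
        (Real.continuous_sqrt.add continuous_const).inv₀ fun t => (hpos t).ne'
      set K := cfc (fun t : ℝ => (√t + ε)⁻¹) (star A * A) with hK
      have hKsa : star K = K := (cfc_predicate (R := ℝ) (p := IsSelfAdjoint) _ _).star_eq
      have hid : cfc (fun t : ℝ => t) (star A * A) = star A * A := cfc_id' ℝ _
      have hKA : K * (star A * A) = cfc (fun t : ℝ => (√t + ε)⁻¹ * t) (star A * A) := by
        rw [cfc_mul (fun t : ℝ => (√t + ε)⁻¹) (fun t => t) _ hc.continuousOn continuousOn_id, hid]
      have hKAK : K * (star A * A) * K =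
          cfc (fun t : ℝ => (√t + ε)⁻¹ * t * (√t + ε)⁻¹) (star A * A) := by
        rw [hKA, hK, ← cfc_mul (fun t : ℝ => (√t + ε)⁻¹ * t) (fun t : ℝ => (√t + ε)⁻¹) _
          (hc.mul continuous_id).continuousOn hc.continuousOn]
      have hW : ‖A * K‖ ≤ 1 := by
        have h1 : ‖A * K‖ * ‖A * K‖ ≤ 1 := by
          rw [← CStarRing.norm_star_mul_self, star_mul, hKsa, mul_assoc, ← mul_assoc (star A),
            ← mul_assoc, hKAK]
          refine norm_cfc_le zero_le_one fun t ht => ?_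
          have ht0 := hspec t ht
          have h2 := hpos t
          rw [Real.norm_of_nonneg (by positivity)]
          have h3 : t ≤ (√t + ε) * (√t + ε) := by
            nlinarith [Real.mul_self_sqrt ht0, Real.sqrt_nonneg t]
          rw [inv_mul_eq_div, ← div_eq_mul_inv, div_div]
          exact (div_le_one (by positivity)).2 h3
        nlinarith [norm_nonneg (A * K)]
      have hdiff : ‖absOp A - K * (star A * A)‖ ≤ ε := by
        rw [hKA, hPdef, ← cfc_sub Real.sqrt (fun t : ℝ => (√t + ε)⁻¹ * t) _ Real.continuous_sqrt.continuousOn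
          (hc.mul continuous_id).continuousOn]
        refine norm_cfc_le hε.le fun t ht => ?_
        have ht0 := hspec t ht
        have h2 := hpos t
        have h4 : √t - (√t + ε)⁻¹ * t = √t * ε / (√t + ε) := by
          field_simp
          nlinarith [Real.mul_self_sqrt ht0]
        rw [h4, Real.norm_of_nonneg (by positivity), div_le_iff₀ h2]
        nlinarith [Real.sqrt_nonneg t]
      have hterm : ∀ i, (⟪e i, absOp A (e i)⟫_ℂ).re ≤
          ‖⟪(A * K) (e i), A (e i)⟫_ℂ‖ + ε := by
        intro i
        have e1 : absOp A (e i) = (K * (star A * A)) (e i) +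
            (absOp A - K * (star A * A)) (e i) := by simp
        have e2 : ⟪e i, (K * (star A * A)) (e i)⟫_ℂ = ⟪(A * K) (e i), A (e i)⟫_ℂ := by
          have : K * (star A * A) = star (A * K) * A := by
            rw [star_mul, hKsa, mul_assoc]
          rw [this]
          exact ContinuousLinearMap.adjoint_inner_right (A * K) (e i) (A (e i))
        rw [e1, inner_add_right, Complex.add_re, e2]
        refine add_le_add (Complex.re_le_norm _) ((Complex.re_le_norm _).trans ?_)
        refine (norm_inner_le_norm _ _).trans ?_
        have := ContinuousLinearMap.le_opNorm (absOp A - K * (star A * A)) (e i)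
        rw [e.orthonormal.1 i] at this ⊢
        linarith
      refine (Finset.sum_le_sum fun i _ => hterm i).trans ?_
      rw [Finset.sum_add_distrib, Finset.sum_const, nsmul_eq_mul]
      have := h (A * K) hW F
      linarith
    refine le_of_forall_pos_le_add fun δ hδ => ?_
    have hc : (0 : ℝ) < F.card + 1 := by positivity
    refine (key2 (δ / (F.card + 1)) (by positivity)).trans ?_
    have : (F.card : ℝ) * (δ / (F.card + 1)) ≤ δ := by
      rw [mul_div_assoc', div_le_iff₀ hc]; nlinarith
    linarith
  have hsum := summable_of_sum_le hnn key
  exact ⟨hsum, hsum.tsum_le_of_sum_le key⟩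

lemma absOp_pos (D : H →L[ℂ] H) (hD : 0 ≤ D) : absOp D = D := by
  have h1 : ContinuousLinearMap.adjoint D = D := hD.isSelfAdjoint.star_eq
  have h2 : 0 ≤ D * D := by
    have := star_mul_self_nonneg D
    rwa [hD.isSelfAdjoint.star_eq] at this
  rw [absOp, h1, ← cfcₙ_eq_cfc, ← CFC.sqrt_eq_real_sqrt _ h2]
  exact CFC.sqrt_unique rfl hD

lemma integral_inner_op {Ω : Type*} [MeasurableSpace Ω] {μ : Measure Ω}
    {B : Ω → H →L[ℂ] H} (hB : Integrable B μ) (x y : H) :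
    Integrable (fun t => ⟪x, B t y⟫_ℂ) μ ∧ ⟪x, (∫ t, B t ∂μ) y⟫_ℂ = ∫ t, ⟪x, B t y⟫_ℂ ∂μ := by
  let L : (H →L[ℂ] H) →L[ℂ] ℂ := (innerSL ℂ x).comp (ContinuousLinearMap.apply ℂ H y)
  exact ⟨L.integrable_comp hB, (L.integral_comp_comm hB).symm⟩

lemma TB.integral {Ω : Type*} [MeasurableSpace Ω] {μ : Measure Ω} {ι : Type*}
    {e : HilbertBasis ι ℂ H}
    {B : Ω → H →L[ℂ] H} (hB : Integrable B μ) {M : Ω → ℝ} (hM : Integrable M μ)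
    (h : ∀ t, TB e (B t) (M t)) : TB e (∫ t, B t ∂μ) (∫ t, M t ∂μ) := by
  intro W hW F
  calc ∑ i ∈ F, ‖⟪W (e i), (∫ t, B t ∂μ) (e i)⟫_ℂ‖
      ≤ ∑ i ∈ F, ∫ t, ‖⟪W (e i), B t (e i)⟫_ℂ‖ ∂μ := by
        refine Finset.sum_le_sum fun i _ => ?_
        rw [(integral_inner_op hB _ _).2]
        exact norm_integral_le_integral_norm _
    _ = ∫ t, ∑ i ∈ F, ‖⟪W (e i), B t (e i)⟫_ℂ‖ ∂μ :=
        (integral_finsetSum _ fun i _ => (integral_inner_op hB _ _).1.norm).symm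
    _ ≤ _ := integral_mono (integrable_finsetSum _ fun i _ => (integral_inner_op hB _ _).1.norm)
        hM fun t => h t W hW F

lemma trace_integral {Ω : Type*} [MeasurableSpace Ω] {μ : Measure Ω} {ι : Type*}
    {e : HilbertBasis ι ℂ H}
    {B : Ω → H →L[ℂ] H} (hB : Integrable B μ) {M : Ω → ℝ} (hM : Integrable M μ)
    (h : ∀ t, TB e (B t) (M t)) : trace e (∫ t, B t ∂μ) = ∫ t, trace e (B t) ∂μ := by
  have := countable_basis e
  simp only [trace]
  simp_rw [(integral_inner_op hB _ _).2]
  refine (integral_tsum_of_summable_integral_norm (fun i => (integral_inner_op hB _ _).1) ?_)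
  refine summable_of_sum_le (c := ∫ t, M t ∂μ) (fun i => integral_nonneg fun t => norm_nonneg _)
    fun F => ?_
  rw [← integral_finsetSum _ fun i _ => (integral_inner_op hB _ _).1.norm]
  exact integral_mono (integrable_finsetSum _ fun i _ => (integral_inner_op hB _ _).1.norm)
        hM fun t => h t 1 ContinuousLinearMap.norm_id_le F

/-- The unitary group `e^{iαY}`. -/
noncomputable def Uop (Y : H →L[ℂ] H) (α : ℝ) : H →L[ℂ] H :=
  NormedSpace.exp (α • (Complex.I • Y))

lemma Uop_eq_fc (Y : H →L[ℂ] H) (hY : IsSelfAdjoint Y) (α : ℝ) :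
    Uop Y α = fc (fun β => Complex.exp (Complex.I * (α : ℂ) * (β : ℂ))) Y := by
  have hn : IsStarNormal Y := hY.isStarNormal
  have h1 : fc (fun β => Complex.exp (Complex.I * (α : ℂ) * (β : ℂ))) Y =
      cfc (fun z : ℂ => Complex.exp ((Complex.I * (α : ℂ)) • z)) Y := by
    refine cfc_congr fun z hz => ?_
    have := hY.mem_spectrum_eq_re hz
    simp only [smul_eq_mul]
    conv_rhs => rw [this]
  have hn2 : IsStarNormal ((Complex.I * (α : ℂ)) • Y) := by
    refine ⟨?_⟩
    rw [star_smul, hY.star_eq]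
    exact ((Commute.refl Y).smul_left _).smul_right _
  rw [h1, cfc_comp_smul _ _ _ (Complex.continuous_exp.continuousOn),
    CFC.complex_exp_eq_normedSpace_exp, Uop]
  congr 1
  rw [mul_comm, mul_smul]
  rfl

lemma norm_Uop_le (Y : H →L[ℂ] H) (hY : IsSelfAdjoint Y) (α : ℝ) : ‖Uop Y α‖ ≤ 1 := by
  rw [Uop_eq_fc Y hY]
  refine norm_cfc_le zero_le_one fun z _ => ?_
  rw [Complex.norm_exp]
  simp

lemma hasDerivAt_Uop (Y : H →L[ℂ] H) (α : ℝ) :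
    HasDerivAt (Uop Y) (Uop Y α * (Complex.I • Y)) α :=
  hasDerivAt_exp_smul_const (𝕂 := ℝ) (Complex.I • Y) α

lemma hasDerivAt_Uop' (Y : H →L[ℂ] H) (α : ℝ) :
    HasDerivAt (Uop Y) ((Complex.I • Y) * Uop Y α) α :=
  hasDerivAt_exp_smul_const' (𝕂 := ℝ) (Complex.I • Y) α

lemma continuous_Uop (Y : H →L[ℂ] H) : Continuous (Uop Y) :=
  continuous_iff_continuousAt.2 fun α => (hasDerivAt_Uop Y α).continuousAt

lemma Uop_zero (Y : H →L[ℂ] H) : Uop Y 0 = 1 := by simp [Uop]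

lemma Uop_add (Y : H →L[ℂ] H) (α β : ℝ) : Uop Y (α + β) = Uop Y α * Uop Y β := by
  letI : NormedAlgebra ℚ (H →L[ℂ] H) := NormedAlgebra.restrictScalars ℚ ℂ _
  rw [Uop, add_smul, NormedSpace.exp_add_of_commute]
  · rfl
  · exact ((Commute.refl _).smul_left _).smul_right _

lemma comm_formula (X Y D2 : H →L[ℂ] H) (hD : Y * X - X * Y = Complex.I • D2) (α : ℝ) :
    Uop Y α * X - X * Uop Y α =
      ∫ s in Set.Ioc (0 : ℝ) 1, (-(α : ℂ)) • (Uop Y (s * α) * D2 * Uop Y ((1 - s) * α)) := by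
  have hd : ∀ s : ℝ, HasDerivAt (fun s : ℝ => Uop Y (s * α) * X * Uop Y ((1 - s) * α))
      ((-(α : ℂ)) • (Uop Y (s * α) * D2 * Uop Y ((1 - s) * α))) s := by
    intro s
    have h1 : HasDerivAt (fun s : ℝ => Uop Y (s * α))
        (α • (Uop Y (s * α) * (Complex.I • Y))) s := by
      have := (hasDerivAt_Uop Y (s * α)).scomp s ((hasDerivAt_id s).mul_const α)
      simpa [Function.comp_def] using this
    have h2 : HasDerivAt (fun s : ℝ => Uop Y ((1 - s) * α))
        ((-α) • ((Complex.I • Y) * Uop Y ((1 - s) * α))) s := by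
      have := (hasDerivAt_Uop' Y ((1 - s) * α)).scomp s
        (((hasDerivAt_id s).const_sub 1).mul_const α)
      simpa [Function.comp_def] using this
    refine ((h1.mul_const X).mul h2).congr_deriv ?_
    have e1 : D2 = -(Complex.I • (Y * X - X * Y)) := by
      rw [hD, smul_smul, Complex.I_mul_I]; simp
    have e2 : ∀ Z : H →L[ℂ] H, α • Z = (α : ℂ) • Z := fun Z => rfl
    have e3 : ∀ Z : H →L[ℂ] H, (-α) • Z = (-(α : ℂ)) • Z := fun Z => by
      rw [neg_smul, neg_smul, e2]
    rw [e1, e2, e3]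
    simp only [smul_mul_assoc, mul_smul_comm, mul_neg, neg_mul, smul_neg, neg_smul, mul_sub,
      sub_mul, smul_sub, neg_neg, mul_assoc]
    abel
  have hcont : Continuous fun s : ℝ =>
      (-(α : ℂ)) • (Uop Y (s * α) * D2 * Uop Y ((1 - s) * α)) := by
    have := continuous_Uop Y
    fun_prop
  have := intervalIntegral.integral_eq_sub_of_hasDerivAt (fun s _ => hd s)
    (hcont.intervalIntegrable 0 1)
  rw [intervalIntegral.integral_of_le zero_le_one] at this
  rw [this]
  simp [Uop_zero]

lemma comm_TB {ι : Type*} (e : HilbertBasis ι ℂ H) (X Y S : H →L[ℂ] H)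
    (hS : IsSelfAdjoint S) (hY : IsSelfAdjoint Y) (hs : Summable fun i => ‖S (e i)‖ ^ 2)
    (hD : Y * X - X * Y = Complex.I • (S * S)) (α : ℝ) :
    TB e (Uop Y α * X - X * Uop Y α) (|α| * ∑' i, ‖S (e i)‖ ^ 2) ∧
    trace e (Uop Y α * X - X * Uop Y α) = -(α : ℂ) * trace e (Uop Y α * (S * S)) := by
  rw [comm_formula X Y _ hD α]
  have hcont : Continuous fun s : ℝ =>
      (-(α : ℂ)) • (Uop Y (s * α) * (S * S) * Uop Y ((1 - s) * α)) := by
    have := continuous_Uop Y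
    fun_prop
  have hint : Integrable (fun s : ℝ =>
      (-(α : ℂ)) • (Uop Y (s * α) * (S * S) * Uop Y ((1 - s) * α)))
      (volume.restrict (Set.Ioc (0:ℝ) 1)) :=
    (hcont.integrableOn_Icc (a := 0) (b := 1)).mono_set Set.Ioc_subset_Icc_self
  have hTB : ∀ s : ℝ, TB e ((-(α : ℂ)) • (Uop Y (s * α) * (S * S) * Uop Y ((1 - s) * α)))
      (|α| * ∑' i, ‖S (e i)‖ ^ 2) := by
    intro s
    have := (TB_main e S _ _ hS (norm_Uop_le Y hY (s * α)) (norm_Uop_le Y hY ((1 - s) * α)) hs).smul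
      (-(α : ℂ))
    simpa using this
  have hM : Integrable (fun _ : ℝ => |α| * ∑' i, ‖S (e i)‖ ^ 2)
    (volume.restrict (Set.Ioc (0:ℝ) 1)) := integrable_const _
  refine ⟨by simpa using TB.integral hint hM hTB, ?_⟩
  rw [trace_integral hint hM hTB]
  have : ∀ s : ℝ, trace e ((-(α : ℂ)) • (Uop Y (s * α) * (S * S) * Uop Y ((1 - s) * α))) =
      -(α : ℂ) * trace e (Uop Y α * (S * S)) := by
    intro s
    rw [trace_smul', trace_cyc e S _ _ hS (norm_Uop_le Y hY _) (norm_Uop_le Y hY _) hs, ← Uop_add]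
    congr 4
    ring
  simp_rw [this]
  simp

lemma integrable_smul_Uop (Y : H →L[ℂ] H) (hY : IsSelfAdjoint Y) (g : ℝ → ℂ)
    (hg : Integrable g) : Integrable (fun α => g α • Uop Y α) := by
  refine hg.norm.mono' (hg.1.smul (continuous_Uop Y).aestronglyMeasurable) ?_
  refine .of_forall fun α => ?_
  rw [norm_smul]
  exact mul_le_of_le_one_right (norm_nonneg _) (norm_Uop_le Y hY α)

lemma fc_integral (Y : H →L[ℂ] H) (hY : IsSelfAdjoint Y) (g : ℝ → ℂ) (hg : Integrable g) :
    fc (fun β => ∫ α : ℝ, Complex.exp (Complex.I * (α : ℂ) * (β : ℂ)) • g α) Y =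
      ∫ α, g α • Uop Y α := by
  have hn : IsStarNormal Y := hY.isStarNormal
  let E0 : C(ℝ × spectrum ℂ Y, ℂ) :=
    ⟨fun p => Complex.exp (Complex.I * (p.1 : ℂ) * ((p.2 : ℂ).re : ℂ)), by fun_prop⟩
  let E : C(ℝ, C(spectrum ℂ Y, ℂ)) := E0.curry
  have hEn : ∀ α, ‖E α‖ ≤ 1 := fun α => by
    refine (ContinuousMap.norm_le _ zero_le_one).2 fun z => ?_
    change ‖Complex.exp (Complex.I * (α : ℂ) * ((z : ℂ).re : ℂ))‖ ≤ 1
    rw [Complex.norm_exp]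
    simp
  have hint : Integrable (fun α => g α • E α) := by
    refine hg.norm.mono' (hg.1.smul E.continuous.aestronglyMeasurable) (.of_forall fun α => ?_)
    rw [norm_smul]
    exact mul_le_of_le_one_right (norm_nonneg _) (hEn α)
  have h1 := cfcHom_integral (𝕜 := ℂ) Y (fun α => g α • E α) hint hn
  have h2 : ∀ α, cfcHom hn (g α • E α) = g α • Uop Y α := by
    intro α
    rw [map_smul, Uop_eq_fc Y hY, fc, cfc_apply _ _ hn (by fun_prop)]
    rfl
  simp_rw [h2] at h1
  rw [h1, fc]
  have h3 : (fun z : ℂ => ∫ α : ℝ, Complex.exp (Complex.I * (α : ℂ) * (z.re : ℂ)) • g α)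
      = fun z : ℂ => ∫ α : ℝ, g α * Complex.exp (Complex.I * (α : ℂ) * (z.re : ℂ)) := by
    ext z; congr 1; ext α; rw [smul_eq_mul, mul_comm]
  have h4 : ∀ z : spectrum ℂ Y, (∫ α, g α • E α) z =
      ∫ α : ℝ, g α * Complex.exp (Complex.I * (α : ℂ) * ((z : ℂ).re : ℂ)) := by
    intro z
    rw [ContinuousMap.integral_apply hint]
    rfl
  have hc : ContinuousOn (fun z : ℂ => ∫ α : ℝ, Complex.exp (Complex.I * (α : ℂ) * (z.re : ℂ)) • g α)
      (spectrum ℂ Y) := by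
    rw [h3, continuousOn_iff_continuous_domRestrict]
    refine (∫ α, g α • E α).continuous.congr fun z => h4 z
  rw [cfc_apply _ _ hn hc]
  congr 1
  ext z
  rw [h4]
  exact congrFun h3 z

lemma deriv_formula (ψ g : ℝ → ℂ) (hg : Integrable g) (hg' : Integrable fun α : ℝ => α • g α)
    (hrep : ∀ β : ℝ, ψ β = ∫ α : ℝ, Complex.exp (Complex.I * (α : ℂ) * (β : ℂ)) • g α) :
    deriv ψ = fun β : ℝ => ∫ α : ℝ, Complex.exp (Complex.I * (α : ℂ) * (β : ℂ)) •
      (Complex.I * (α : ℂ) * g α) := by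
  ext β
  have hψ : ψ = fun β : ℝ => ∫ α : ℝ, Complex.exp (Complex.I * (α : ℂ) * (β : ℂ)) • g α :=
    funext hrep
  have hnorm : ∀ α β : ℝ, ‖Complex.exp (Complex.I * (α : ℂ) * (β : ℂ))‖ = 1 := by
    intro α β; rw [Complex.norm_exp]; simp
  have hmeas : ∀ β : ℝ, AEStronglyMeasurable
      (fun α : ℝ => Complex.exp (Complex.I * (α : ℂ) * (β : ℂ)) • g α) volume := fun β =>
    AEStronglyMeasurable.smul (by fun_prop : Continuous fun α : ℝ =>
      Complex.exp (Complex.I * (α : ℂ) * (β : ℂ))).aestronglyMeasurable hg.1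
  rw [hψ]
  refine (hasDerivAt_integral_of_dominated_loc_of_deriv_le (bound := fun α => ‖α • g α‖)
    (F' := fun β α => Complex.exp (Complex.I * (α : ℂ) * (β : ℂ)) • (Complex.I * (α : ℂ) * g α))
    Filter.univ_mem (.of_forall hmeas) ?_ ?_ ?_ hg'.norm ?_).2.deriv
  · refine hg.norm.mono' (hmeas β) (.of_forall fun α => ?_)
    rw [norm_smul, hnorm, one_mul]
  · refine AEStronglyMeasurable.smul (by fun_prop : Continuous fun α : ℝ =>
      Complex.exp (Complex.I * (α : ℂ) * (β : ℂ))).aestronglyMeasurable ?_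
    exact AEStronglyMeasurable.mul (by fun_prop : Continuous fun α : ℝ =>
      Complex.I * (α : ℂ)).aestronglyMeasurable hg.1
  · refine .of_forall fun α x _ => ?_
    rw [norm_smul, hnorm, one_mul, norm_smul]
    simp
  · refine .of_forall fun α x _ => ?_
    have h1 : HasDerivAt (fun x : ℝ => Complex.I * (α : ℂ) * (x : ℂ)) (Complex.I * (α : ℂ)) x := by
      simpa using (Complex.ofRealCLM.hasDerivAt (x := x)).const_mul (Complex.I * (α : ℂ))
    have := (h1.cexp).mul_const (g α)
    simpa [mul_assoc] using this

theorem statement0 {ι : Type*} (e : HilbertBasis ι ℂ H) (X Y D2 : H →L[ℂ] H)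
    (a b : ℝ) (hA : AssumptionA e X Y D2 a b)
    (ψ g : ℝ → ℂ) (hg : Integrable g) (hg' : Integrable fun α : ℝ => α • g α)
    (hrep : ∀ β : ℝ, ψ β = (Real.sqrt (2 * Real.pi))⁻¹ •
      ∫ α : ℝ, Complex.exp (Complex.I * (α : ℂ) * (β : ℂ)) • g α) :
    IsTraceClass e (fc ψ Y * X - X * fc ψ Y) ∧
    traceNorm e (fc ψ Y * X - X * fc ψ Y) ≤
      traceNorm e D2 * ((Real.sqrt (2 * Real.pi))⁻¹ * ∫ α : ℝ, ‖g α‖ * |α|) ∧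
    (-Complex.I) * trace e (fc ψ Y * X - X * fc ψ Y) = trace e (fc (deriv ψ) Y * D2) := by
  have hD0 : 0 ≤ D2 := (ContinuousLinearMap.nonneg_iff_isPositive _).2 hA.hpos
  set S := CFC.sqrt D2 with hSdef
  have hS : IsSelfAdjoint S := (CFC.sqrt_nonneg D2).isSelfAdjoint
  have hSS : S * S = D2 := CFC.sqrt_mul_sqrt_self D2 hD0
  have hY := hA.hY
  have hcomm : Y * X - X * Y = Complex.I • (S * S) := by
    have h := congrArg (fun Z => ((2 : ℂ)⁻¹ * Complex.I) • Z) hA.hD2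
    simp only [smul_smul] at h
    rw [hSS]
    have c1 : (2 : ℂ)⁻¹ * Complex.I * 2 = Complex.I := by ring
    have c2 : (2 : ℂ)⁻¹ * Complex.I * (-2 * Complex.I) = 1 := by
      linear_combination (-1 : ℂ) * Complex.I_mul_I
    rw [c1, c2, one_smul] at h
    exact h.symm
  have hterm : ∀ i, (⟪e i, absOp D2 (e i)⟫_ℂ).re = ‖S (e i)‖ ^ 2 := by
    intro i
    rw [absOp_pos D2 hD0, ← hSS]
    have := inner_USSV S 1 1 hS (e i) (e i)
    have h1 : ContinuousLinearMap.adjoint (1 : H →L[ℂ] H) = 1 := star_one (H →L[ℂ] H)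
    rw [h1] at this
    simp only [one_mul, mul_one, one_apply_eq_self] at this
    rw [this, inner_self_eq_norm_sq_to_K]
    norm_cast
  have hs : Summable fun i => ‖S (e i)‖ ^ 2 := hA.htc.congr hterm
  have hN : traceNorm e D2 = ∑' i, ‖S (e i)‖ ^ 2 := tsum_congr hterm
  set N := ∑' i, ‖S (e i)‖ ^ 2 with hNdef
  set c : ℝ := (Real.sqrt (2 * Real.pi))⁻¹ with hc
  have hc0 : 0 ≤ c := by positivity
  let k : ℝ → ℂ := fun α => c • g α
  have hk : Integrable k := hg.smul c
  have hk' : Integrable fun α : ℝ => α • k α := by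
    refine (hg'.smul c).congr (.of_forall fun α => ?_)
    exact smul_comm c α (g α)
  have hrepk : ∀ β : ℝ, ψ β = ∫ α : ℝ, Complex.exp (Complex.I * (α : ℂ) * (β : ℂ)) • k α := by
    intro β
    rw [hrep β, ← integral_smul]
    congr 1; ext α
    exact smul_comm c _ (g α)
  have hψY : fc ψ Y = ∫ α, k α • Uop Y α := by
    rw [← fc_integral Y hY k hk]
    exact congrArg (fun f => fc f Y) (funext hrepk)
  have hkU := integrable_smul_Uop Y hY k hk
  have hI1 : Integrable fun α => (k α • Uop Y α) * X := hkU.mul_const X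
  have hI2 : Integrable fun α => X * (k α • Uop Y α) := hkU.const_mul X
  have hAint : fc ψ Y * X - X * fc ψ Y = ∫ α, k α • (Uop Y α * X - X * Uop Y α) := by
    rw [hψY, ← integral_mul_const_of_integrable hkU, ← integral_const_mul_of_integrable hkU,
      ← integral_sub hI1 hI2]
    congr 1; ext1 α
    rw [smul_sub, smul_mul_assoc, mul_smul_comm]
  have hBint : Integrable fun α => k α • (Uop Y α * X - X * Uop Y α) := by
    refine (hI1.sub hI2).congr (.of_forall fun α => ?_)
    simp only [Pi.sub_apply]
    rw [smul_sub, smul_mul_assoc, mul_smul_comm]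
  have hcm := fun α => comm_TB e X Y S hS hY hs hcomm α
  have hTB : ∀ α, TB e (k α • (Uop Y α * X - X * Uop Y α)) (‖k α‖ * (|α| * N)) :=
    fun α => (hcm α).1.smul (k α)
  have hMint : Integrable fun α => ‖k α‖ * (|α| * N) := by
    refine (hk'.norm.mul_const N).congr (.of_forall fun α => ?_)
    simp only [norm_smul, Real.norm_eq_abs]
    ring
  have hMeq : ∫ α, ‖k α‖ * (|α| * N) = N * (c * ∫ α : ℝ, ‖g α‖ * |α|) := by
    rw [← integral_const_mul, ← integral_const_mul]
    congr 1; ext α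
    simp only [k, norm_smul, Real.norm_eq_abs, abs_of_nonneg hc0]
    ring
  have hTBA := TB.integral hBint hMint hTB
  rw [← hAint, hMeq] at hTBA
  refine ⟨hTBA.traceClass.1, hN ▸ hTBA.traceClass.2, ?_⟩
  -- the trace formula
  have hkd : Integrable fun α : ℝ => Complex.I * (α : ℂ) * k α := by
    refine (hk'.const_mul Complex.I).congr (.of_forall fun α => ?_)
    simp [mul_assoc]
  have hkdU := integrable_smul_Uop Y hY _ hkd
  have hψ'Y : fc (deriv ψ) Y * D2 =
      ∫ α : ℝ, (Complex.I * (α : ℂ) * k α) • (Uop Y α * (S * S)) := by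
    rw [deriv_formula ψ k hk hk' hrepk, fc_integral Y hY _ hkd,
      ← integral_mul_const_of_integrable hkdU, hSS]
    congr 1
  have hCint : Integrable fun α : ℝ => (Complex.I * (α : ℂ) * k α) • (Uop Y α * (S * S)) := by
    refine (hkdU.mul_const (S * S)).congr (.of_forall fun α => ?_)
    simp only [smul_mul_assoc]
  have hTBC : ∀ α : ℝ, TB e ((Complex.I * (α : ℂ) * k α) • (Uop Y α * (S * S)))
      (‖Complex.I * (α : ℂ) * k α‖ * N) := by
    intro α
    have := TB_main e S (Uop Y α) 1 hS (norm_Uop_le Y hY α) ContinuousLinearMap.norm_id_le hs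
    rw [mul_one] at this
    exact this.smul _
  rw [hAint, hψ'Y, trace_integral hBint hMint hTB, trace_integral hCint (hkd.norm.mul_const N) hTBC,
    ← integral_const_mul]
  congr 1; ext α
  rw [trace_smul', trace_smul', (hcm α).2]
  ring

end HHCP
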